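/- An even unimodular symmetric bilinear form over ℤ has signature divisible by 8. -/

import Mathlib

open Matrix

theorem equivalent_weightedSumSquares_of_transpose_mul_mul {n : Type*} [Fintype n] [DecidableEq n]
    {A P : Matrix n n ℝ} {d : n → ℝ} (hP : IsUnit P.det) (h : Pᵀ * A * P = diagonal d) :
    A.toQuadraticForm'.Equivalent (QuadraticMap.weightedSumSquares ℝ d) := by
  refine QuadraticMap.Equivalent.symm ⟨{ P.toLinearEquiv' (P.invertibleOfIsUnitDet hP) with
    map_app' := fun v => ?_ }⟩
  change A.toQuadraticForm' (P *ᵥ v) = _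
  rw [toQuadraticForm', LinearMap.BilinMap.toQuadraticMap_apply, toLinearMap₂'_apply',
    dotProduct_mulVec, vecMul_mulVec, ← dotProduct_mulVec, mulVec_mulVec, h,
    QuadraticMap.weightedSumSquares_apply]
  simp only [dotProduct, mulVec_diagonal, smul_eq_mul]
  exact Finset.sum_congr rfl fun i _ => by ring

theorem exists_int_diagonalization {n : Type*} [Fintype n] [DecidableEq n]
    {M : Matrix n n ℤ} (hM : M.IsSymm) :
    ∃ (P : Matrix n n ℤ) (d : n → ℤ), P.det ≠ 0 ∧ Pᵀ * M * P = diagonal d := by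
  set A : Matrix n n ℚ := M.map (Int.cast) with hA
  have hAs : A.IsSymm := hM.map _
  have hB : LinearMap.IsSymm (toLinearMap₂' ℚ A) := by
    refine ⟨fun x y => ?_⟩
    rw [RingHom.id_apply, toLinearMap₂'_apply', toLinearMap₂'_apply', dotProduct_comm, dotProduct_mulVec,
      ← mulVec_transpose, hAs.eq, dotProduct_comm]
  obtain ⟨v, hv⟩ := LinearMap.BilinForm.exists_orthogonal_basis hB
  have hc : Fintype.card (Fin (Module.finrank ℚ (n → ℚ))) = Fintype.card n := by simp
  let w := v.reindex (Fintype.equivOfCardEq hc)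
  let Q := (Pi.basisFun ℚ n).toMatrix w
  have hQ : Q.det ≠ 0 := by
    have := (Pi.basisFun ℚ n).invertibleToMatrix w
    exact (isUnit_det_of_invertible Q).ne_zero
  have hQA : ∀ i j, i ≠ j → (Qᵀ * A * Q) i j = 0 := by
    intro i j hij
    have h := hv (fun h => hij ((Fintype.equivOfCardEq hc).symm.injective h))
    rw [Function.onFun, ← v.reindex_apply, ← v.reindex_apply] at h
    rw [toLinearMap₂'_apply'] at h
    rw [Matrix.mul_assoc]
    exact h
  obtain ⟨b, hb⟩ := IsLocalization.exist_integer_multiples_of_finite (nonZeroDivisors ℤ)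
    (fun p : n × n => Q p.1 p.2)
  choose P hP using hb
  have hb0 : (b : ℤ) ≠ 0 := nonZeroDivisors.coe_ne_zero b
  let P' : Matrix n n ℤ := of fun i j => P (i, j)
  have hPQ : P'.map (Int.castRingHom ℚ) = (b : ℚ) • Q := by
    ext i j; simpa [P'] using hP (i, j)
  refine ⟨P', fun i => (P'ᵀ * M * P') i i, fun h0 => ?_, ?_⟩
  · have := congrArg det hPQ
    rw [← RingHom.mapMatrix_apply, ← RingHom.map_det, h0, det_smul, map_zero] at this
    simp_all
  · ext i j
    rcases eq_or_ne i j with rfl | hij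
    · simp
    · have h : (P'ᵀ * M * P').map (Int.castRingHom ℚ) = (b : ℚ) • (b : ℚ) • (Qᵀ * A * Q) := by
        have hA' : M.map (Int.castRingHom ℚ) = A := rfl
        rw [Matrix.map_mul, Matrix.map_mul, transpose_map, hPQ, hA']
        simp only [transpose_smul, smul_mul, Matrix.mul_smul]
      have := congrFun₂ h i j
      rw [Matrix.smul_apply, Matrix.smul_apply, hQA i j hij] at this
      simpa [hij] using this

open Complex Filter Topology Real in
theorem tendsto_sqrt_mul_evenKernel (r : ℤ) {N : ℕ} (hN : 0 < N) :
    Tendsto (fun t : ℝ => √t * HurwitzZeta.evenKernel ((r / N : ℝ) : UnitAddCircle) (N ^ 2 * t))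
      (𝓝[>] 0) (𝓝 (1 / N)) := by
  have hN' : (0 : ℝ) < N := by exact_mod_cast hN
  have hcos : Tendsto (HurwitzZeta.cosKernel ((r / N : ℝ) : UnitAddCircle)) atTop (𝓝 1) := by
    obtain ⟨p, hp, h⟩ := HurwitzZeta.isBigO_atTop_cosKernel_sub ((r / N : ℝ) : UnitAddCircle)
    have h0 : Tendsto (fun x : ℝ => rexp (-p * x)) atTop (𝓝 0) := by
      refine Real.tendsto_exp_atBot.comp ?_
      exact tendsto_id.const_mul_atTop_of_neg (neg_lt_zero.2 hp)
    simpa using (h.trans_tendsto h0).add_const 1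
  have hlim : Tendsto (fun t : ℝ => 1 / ((N : ℝ) ^ 2 * t)) (𝓝[>] 0) atTop := by
    have := tendsto_inv_nhdsGT_zero (𝕜 := ℝ) |>.const_mul_atTop (r := ((N : ℝ) ^ 2)⁻¹)
      (by positivity)
    refine this.congr fun t => ?_
    rw [one_div, mul_inv]
  have := (hcos.comp hlim).const_mul (1 / (N : ℝ))
  rw [mul_one] at this
  refine this.congr' ?_
  filter_upwards [self_mem_nhdsWithin] with t ht
  have ht : 0 < t := ht
  rw [HurwitzZeta.evenKernel_functional_equation, ← Real.sqrt_eq_rpow, Real.sqrt_mul (by positivity),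
    Real.sqrt_sq hN'.le]
  have : √t ≠ 0 := (Real.sqrt_pos.2 ht).ne'
  simp only [Function.comp]
  field_simp

open Complex Real in
theorem jacobiTheta_eq_sum_evenKernel {a N : ℕ} (ha : 0 < a) (hN : 0 < N) (haN : 2 * a ∣ N)
    {t : ℝ} (ht : 0 < t) :
    jacobiTheta (1 / (2 * a) + I * t) = ∑ r : Fin N, cexp (π * I * (r : ℕ) ^ 2 / (2 * a)) *
      HurwitzZeta.evenKernel (((r : ℕ) / N : ℝ) : UnitAddCircle) (N ^ 2 * t) := by
  have : NeZero N := ⟨hN.ne'⟩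
  have hN' : (N : ℝ) ≠ 0 := by exact_mod_cast hN.ne'
  have ha' : (a : ℂ) ≠ 0 := by exact_mod_cast ha.ne'
  have hs : HasSum (fun n : ℤ => cexp (π * I * (n : ℂ) ^ 2 * (1 / (2 * a) + I * t)))
      (jacobiTheta (1 / (2 * a) + I * t)) := by
    have him : 0 < (1 / (2 * a : ℂ) + I * t).im := by
      have : (1 / (2 * a : ℂ)) = ((1 / (2 * a : ℝ) : ℝ) : ℂ) := by push_cast; rfl
      rw [this]; simpa using ht
    rw [jacobiTheta_eq_jacobiTheta₂]
    simpa [jacobiTheta₂_term] using hasSum_jacobiTheta₂_term 0 him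
  rw [← (Int.divModEquiv N).symm.hasSum_iff, ← (Equiv.prodComm (Fin N) ℤ).hasSum_iff] at hs
  refine (hs.prod_fiberwise fun r => ?_).unique (hasSum_fintype _)
  have hk := (HurwitzZeta.hasSum_int_evenKernel ((r : ℕ) / N : ℝ)
    (t := N ^ 2 * t) (by positivity))
  rw [← hasSum_ofReal] at hk
  have hmul := hk.mul_left (cexp (π * I * (r : ℕ) ^ 2 / (2 * a)))
  refine (congrArg (fun f => HasSum f _) ?_).mpr hmul
  funext n
  change cexp (π * I * ((n * N + (r : ℕ) : ℤ) : ℂ) ^ 2 * _) = _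
  obtain ⟨k, rfl⟩ := haN
  rw [ofReal_exp, ← Complex.exp_add, Complex.exp_eq_exp_iff_exists_int]
  refine ⟨n * k * r + n ^ 2 * k ^ 2 * a, ?_⟩
  have hk0 : (k : ℂ) ≠ 0 := by rintro h; simp_all
  push_cast
  field_simp
  ring_nf
  simp only [I_sq]
  ring

open Complex Filter Topology in
theorem tendsto_jacobiTheta_comap_im_atTop : Tendsto jacobiTheta (comap im atTop) (𝓝 1) := by
  have h0 : Tendsto (fun τ : ℂ => Real.exp (-Real.pi * τ.im)) (comap im atTop) (𝓝 0) :=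
    Real.tendsto_exp_atBot.comp
      (tendsto_comap.const_mul_atTop_of_neg (neg_lt_zero.2 Real.pi_pos))
  simpa using (isBigO_at_im_infty_jacobiTheta_sub_one.trans_tendsto h0).add_const 1

theorem jacobiTheta_add_two_mul (a : ℕ) (τ : ℂ) : jacobiTheta (τ + 2 * a) = jacobiTheta τ := by
  induction a with
  | zero => simp
  | succ a ih =>
    rw [← ih, ← jacobiTheta_two_add (τ + 2 * a)]
    congr 1
    push_cast
    ring

open Complex in
theorem jacobiTheta_functional_equation (τ : ℂ) :
    jacobiTheta τ = 1 / (-I * τ) ^ (1 / 2 : ℂ) * jacobiTheta (-1 / τ) := by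
  rw [jacobiTheta_eq_jacobiTheta₂, jacobiTheta₂_functional_equation, jacobiTheta_eq_jacobiTheta₂]
  simp

open Complex Real in
theorem sqrt_mul_jacobiTheta_eq {a : ℕ} (ha : 0 < a) {t : ℝ} (ht : 0 < t) :
    (√t : ℂ) * jacobiTheta (1 / (2 * a) + I * t) =
      1 / (-I * (1 / (2 * a) + I * t)) ^ (1 / 2 : ℂ) *
      (1 / (2 * a / (1 / (2 * a) + I * t)) ^ (1 / 2 : ℂ)) *
      jacobiTheta (((1 / (4 * a ^ 2 * t) : ℝ) : ℂ) * I - 1 / (2 * a)) := by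
  have ha' : (a : ℂ) ≠ 0 := by exact_mod_cast ha.ne'
  have ht' : (t : ℂ) ≠ 0 := by exact_mod_cast ht.ne'
  have hst : (√t : ℂ) ≠ 0 := by exact_mod_cast (Real.sqrt_pos.2 ht).ne'
  set τ : ℂ := 1 / (2 * a) + I * t with hτ
  have hτ0 : τ ≠ 0 := by
    intro h
    have := congrArg im h
    have h2 : (1 / (2 * a : ℂ)) = ((1 / (2 * a : ℝ) : ℝ) : ℂ) := by push_cast; rfl
    rw [hτ, h2] at this
    simp at this
    exact ht.ne' this
  have hw : -1 / τ + 2 * a = 2 * a * I * t / τ := by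
    field_simp
    rw [hτ]; field_simp; ring
  rw [jacobiTheta_functional_equation τ, ← jacobiTheta_add_two_mul a, hw,
    jacobiTheta_functional_equation (2 * a * I * t / τ)]
  have h1 : -I * (2 * a * I * t / τ) = t * (2 * a / τ) := by
    field_simp; rw [I_sq]; ring
  have h2 : -1 / (2 * a * I * t / τ) = ((1 / (4 * a ^ 2 * t) : ℝ) : ℂ) * I - 1 / (2 * a) := by
    rw [hτ]; push_cast; field_simp; ring_nf; simp only [I_sq]; ring
  have h3 : ((t : ℂ) ^ (1 / 2 : ℂ)) = √t := by
    rw [Real.sqrt_eq_rpow, ofReal_cpow ht.le]; simp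
  have h4 : ((t : ℂ) * (2 * a / τ)) ^ (1 / 2 : ℂ) = √t * (2 * a / τ) ^ (1 / 2 : ℂ) := by
    have h5 : 2 * a / τ ≠ 0 := div_ne_zero (mul_ne_zero two_ne_zero ha') hτ0
    rw [← h3, cpow_def_of_ne_zero (mul_ne_zero ht' h5), cpow_def_of_ne_zero ht',
      cpow_def_of_ne_zero h5, ← Complex.exp_add, log_ofReal_mul ht h5,
      ofReal_log ht.le, add_mul]
  rw [h1, h2, h4]
  field_simp

open Complex Filter Topology Real in
theorem tendsto_sqrt_mul_jacobiTheta {a : ℕ} (ha : 0 < a) :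
    Tendsto (fun t : ℝ => (√t : ℂ) * jacobiTheta (1 / (2 * a) + I * t)) (𝓝[>] 0)
      (𝓝 ((1 / √(2 * a) : ℝ) * cexp (π * I / 4))) := by
  have ha' : (0 : ℝ) < a := by exact_mod_cast ha
  have hac : (a : ℂ) ≠ 0 := by exact_mod_cast ha.ne'
  have h2 : (1 / (2 * a : ℂ)) = ((1 / (2 * a : ℝ) : ℝ) : ℂ) := by push_cast; rfl
  have hτ : Tendsto (fun t : ℝ => 1 / (2 * a) + I * t) (𝓝[>] 0) (𝓝 (1 / (2 * a))) := by
    have : Continuous fun t : ℝ => 1 / (2 * a) + I * (t : ℂ) := by fun_prop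
    simpa using (this.tendsto 0).mono_left nhdsWithin_le_nhds
  have hA : Tendsto (fun t : ℝ => (-I * (1 / (2 * a) + I * t)) ^ (1 / 2 : ℂ)) (𝓝[>] 0)
      (𝓝 ((-I * (1 / (2 * a))) ^ (1 / 2 : ℂ))) := by
    refine (hτ.const_mul (-I)).cpow tendsto_const_nhds (Or.inr ?_)
    rw [h2]
    simpa using ha'.ne'
  have hB : Tendsto (fun t : ℝ => (2 * a / (1 / (2 * a) + I * t)) ^ (1 / 2 : ℂ)) (𝓝[>] 0)
      (𝓝 ((2 * a / (1 / (2 * a))) ^ (1 / 2 : ℂ))) := by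
    refine (tendsto_const_nhds.div hτ (by simpa using hac)).cpow tendsto_const_nhds (Or.inl ?_)
    have : (2 * a / (1 / (2 * a)) : ℂ) = ((4 * a ^ 2 : ℝ) : ℂ) := by
      push_cast; field_simp; norm_num
    rw [this, ofReal_re]
    positivity
  have hC : Tendsto (fun t : ℝ => jacobiTheta (((1 / (4 * a ^ 2 * t) : ℝ) : ℂ) * I - 1 / (2 * a)))
      (𝓝[>] 0) (𝓝 1) := by
    refine tendsto_jacobiTheta_comap_im_atTop.comp (tendsto_comap_iff.2 ?_)
    have := tendsto_inv_nhdsGT_zero (𝕜 := ℝ) |>.const_mul_atTop (r := (4 * (a : ℝ) ^ 2)⁻¹)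
      (by positivity)
    refine this.congr fun t => ?_
    rw [Function.comp, h2, sub_im, ofReal_im, im_ofReal_mul, I_im, mul_one, sub_zero, one_div,
      mul_inv, mul_inv, mul_inv]
  have hA0 : (-I * (1 / (2 * a)) : ℂ) ^ (1 / 2 : ℂ) = (1 / √(2 * a) : ℝ) * cexp (- (π * I / 4)) := by
    have : (-I * (1 / (2 * a)) : ℂ) = ((1 / (2 * a) : ℝ) : ℂ) * -I := by push_cast; ring
    rw [this, cpow_def_of_ne_zero (by rw [← h2]; simpa using hac),
      log_ofReal_mul (by positivity) (by simp), log_neg_I, add_mul, Complex.exp_add]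
    congr 1
    · rw [one_div √_, ← Real.sqrt_inv, ← one_div, Real.sqrt_eq_rpow,
        Real.rpow_def_of_pos (by positivity), ofReal_exp, ofReal_mul]
      norm_num
    · congr 1; ring
  have hB0 : (2 * a / (1 / (2 * a)) : ℂ) ^ (1 / 2 : ℂ) = (2 * a : ℝ) := by
    have : (2 * a / (1 / (2 * a)) : ℂ) = (((2 * a) ^ 2 : ℝ) : ℂ) := by
      push_cast; field_simp
    have h : (1 / 2 : ℂ) = ((1 / 2 : ℝ) : ℂ) := by push_cast; rfl
    rw [this, h, ← ofReal_cpow (by positivity), ← Real.sqrt_eq_rpow, Real.sqrt_sq (by positivity)]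
  have hs : √(2 * a : ℝ) ≠ 0 := by positivity
  have hs2 : (√(2 * a : ℝ) : ℂ) ^ 2 = 2 * a := by
    rw [← ofReal_pow, Real.sq_sqrt (by positivity)]; push_cast; rfl
  rw [hA0] at hA
  rw [hB0] at hB
  have hlim := ((tendsto_const_nhds (x := (1 : ℂ))).div hA
    (mul_ne_zero (by simpa using ha'.ne') (Complex.exp_ne_zero _)) |>.mul
      ((tendsto_const_nhds (x := (1 : ℂ))).div hB (by simpa using ha'.ne'))).mul hC
  have he : 1 / ((1 / √(2 * a) : ℝ) * cexp (-(π * I / 4))) * (1 / ((2 * a : ℝ) : ℂ)) * 1 =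
      (1 / √(2 * a) : ℝ) * cexp (π * I / 4) := by
    rw [Complex.exp_neg]
    have hs' : (√(2 * a : ℝ) : ℂ) ≠ 0 := by exact_mod_cast hs
    push_cast
    field_simp
    rw [← hs2]
  rw [he] at hlim
  refine hlim.congr' ?_
  filter_upwards [self_mem_nhdsWithin] with t ht
  exact (sqrt_mul_jacobiTheta_eq ha ht).symm

theorem ZMod.sum_eq_sum_fin {N : ℕ} [NeZero N] {β : Type*} [AddCommMonoid β] (f : ZMod N → β) :
    ∑ x, f x = ∑ r : Fin N, f ((r : ℕ) : ZMod N) := by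
  obtain _ | n := N
  · exact absurd rfl (NeZero.ne 0)
  · exact Finset.sum_congr rfl fun x _ => congrArg f (Fin.cast_val_eq_self (n := n + 1) x).symm

open Complex Filter Topology Real in
theorem sum_stdAddChar_mul_sq_of_pos {N a c : ℕ} [NeZero N] (h : N = 4 * a * c) :
    ∃ r : ℝ, 0 < r ∧
      ∑ x : ZMod N, ZMod.stdAddChar ((c : ZMod N) * x ^ 2) = r * cexp (π * I / 4) := by
  have hN : 0 < N := NeZero.pos N
  have ha : 0 < a := Nat.pos_of_ne_zero fun h0 => by simp [h0] at h; omega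
  have hc : 0 < c := Nat.pos_of_ne_zero fun h0 => by simp [h0] at h; omega
  have hNc : (N : ℂ) ≠ 0 := by exact_mod_cast hN.ne'
  have hac : (a : ℂ) ≠ 0 := by exact_mod_cast ha.ne'
  have hcc : (c : ℂ) ≠ 0 := by exact_mod_cast hc.ne'
  have hterm (x : ℕ) : ZMod.stdAddChar ((c : ZMod N) * (x : ZMod N) ^ 2) =
      cexp (π * I * x ^ 2 / (2 * a)) := by
    have := ZMod.stdAddChar_coe (N := N) (c * x ^ 2)
    push_cast at this
    rw [this, h]
    congr 1
    push_cast
    field_simp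
    ring
  have hlim : Tendsto (fun t : ℝ => (√t : ℂ) * jacobiTheta (1 / (2 * a) + I * t)) (𝓝[>] 0)
      (𝓝 (∑ r : Fin N, cexp (π * I * (r : ℕ) ^ 2 / (2 * a)) * ((1 / N : ℝ) : ℂ))) := by
    have := tendsto_finsetSum (Finset.univ : Finset (Fin N)) fun r _ =>
      ((continuous_ofReal.tendsto _).comp (tendsto_sqrt_mul_evenKernel (r : ℕ) hN)).const_mul
        (cexp (π * I * (r : ℕ) ^ 2 / (2 * a)))
    refine this.congr' ?_
    filter_upwards [self_mem_nhdsWithin] with t ht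
    rw [jacobiTheta_eq_sum_evenKernel ha hN ⟨2 * c, by rw [h]; ring⟩ ht, Finset.mul_sum]
    refine Finset.sum_congr rfl fun r _ => ?_
    simp only [Function.comp, ofReal_mul, Int.cast_natCast]
    ring
  have heq := tendsto_nhds_unique hlim (tendsto_sqrt_mul_jacobiTheta ha)
  rw [← Finset.sum_mul] at heq
  refine ⟨N * (1 / √(2 * a)), by positivity, ?_⟩
  rw [ZMod.sum_eq_sum_fin, Finset.sum_congr rfl fun (r : Fin N) _ => hterm r, ofReal_mul, mul_assoc,
    ← heq]
  push_cast
  field_simp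

open Complex Real in
theorem sum_stdAddChar_mul_sq {N : ℕ} [NeZero N] {c d : ℤ} (hd : 2 ∣ d) (h : (N : ℤ) = 2 * c * d) :
    ∃ r : ℝ, 0 < r ∧
      ∑ x : ZMod N, ZMod.stdAddChar ((c : ZMod N) * x ^ 2) = r * cexp (π * I / 4 * d.sign) := by
  obtain ⟨a, rfl⟩ := hd
  have hN : (0 : ℤ) < N := by exact_mod_cast NeZero.pos N
  have hca : 0 < c * a := by linarith [show 2 * c * (2 * a) = 4 * (c * a) by ring]
  rcases pos_and_pos_or_neg_and_neg_of_mul_pos hca with ⟨hc, ha⟩ | ⟨hc, ha⟩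
  · lift c to ℕ using hc.le
    lift a to ℕ using ha.le
    obtain ⟨r, hr, hs⟩ := sum_stdAddChar_mul_sq_of_pos (N := N) (a := a) (c := c)
      (by zify; rw [h]; ring)
    refine ⟨r, hr, ?_⟩
    rw [Int.sign_eq_one_of_pos (by positivity)]
    simpa using hs
  · obtain ⟨c', hc'⟩ := Int.eq_ofNat_of_zero_le (neg_nonneg.2 hc.le)
    obtain ⟨a', ha'⟩ := Int.eq_ofNat_of_zero_le (neg_nonneg.2 ha.le)
    obtain rfl : c = -c' := by omega
    obtain rfl : a = -a' := by omega
    obtain ⟨r, hr, hs⟩ := sum_stdAddChar_mul_sq_of_pos (N := N) (a := a') (c := c')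
      (by zify; rw [h]; ring)
    refine ⟨r, hr, ?_⟩
    rw [Int.sign_eq_neg_one_of_neg (by linarith)]
    have := congrArg (starRingEnd ℂ) hs
    rw [map_sum] at this
    simp only [← AddChar.map_neg_eq_conj] at this
    push_cast
    simp only [neg_mul]
    rw [this, map_mul, conj_ofReal, ← exp_conj]
    congr 2
    rw [map_div₀, map_mul, conj_ofReal, conj_I, map_ofNat]
    ring

theorem sum_eq_card_of_map_add_eq_mul {A B : Type*} [AddCommGroup A] [Fintype A]
    [AddCommGroup B] [Fintype B] {f : A → ℂ} {φ : B → A} {χ : A → AddChar B ℂ}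
    [DecidablePred fun k => χ k = 0]
    (hf : ∀ k y, f (k + φ y) = f k * χ k y) (hχ : ∀ k, χ k = 0 → f k = 1) :
    ∑ k, f k = (Finset.univ.filter fun k => χ k = 0).card := by
  classical
  have hB : (Fintype.card B : ℂ) ≠ 0 := by exact_mod_cast Fintype.card_ne_zero
  refine mul_right_cancel₀ hB ?_
  calc (∑ k, f k) * Fintype.card B = ∑ y : B, ∑ k, f (k + φ y) := by
        have hshift (y : B) : ∑ k, f (k + φ y) = ∑ k, f k :=
          Equiv.sum_comp (Equiv.addRight (φ y)) f
        simp [hshift, mul_comm]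
    _ = ∑ k, f k * ∑ y, χ k y := by
        rw [Finset.sum_comm]
        simp_rw [hf, Finset.mul_sum]
    _ = ∑ k, if χ k = 0 then (Fintype.card B : ℂ) else 0 := by
        refine Finset.sum_congr rfl fun k _ => ?_
        rw [AddChar.sum_eq_ite]
        split_ifs with h
        · rw [hχ k h, one_mul]
        · rw [mul_zero]
    _ = _ := by
        rw [← Finset.sum_filter, Finset.sum_const, nsmul_eq_mul]

section

variable {n : Type*} [Fintype n] [DecidableEq n]

theorem mul_eq_smul_one_symm {X Y : Matrix n n ℤ} {N : ℤ} (h : X * Y = N • (1 : Matrix n n ℤ))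
    (hX : X.det ≠ 0) : Y * X = N • (1 : Matrix n n ℤ) := by
  refine smul_right_injective _ hX ?_
  calc X.det • (Y * X) = X.adjugate * X * (Y * X) := by
        rw [adjugate_mul, smul_mul, Matrix.one_mul]
    _ = X.adjugate * (X * Y * X) := by simp only [Matrix.mul_assoc]
    _ = X.det • N • (1 : Matrix n n ℤ) := by
        rw [h, smul_mul, Matrix.one_mul, Matrix.mul_smul, adjugate_mul, smul_comm]

/-- If `Pᵀ * M * P = diagonal d` and `N = 2 * c i * d i`, then `diagonal c` is `N / 2` times the
inverse of the diagonalized form, and this transports it back to `M`. -/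
theorem two_smul_mul_diagonal_mul {M P : Matrix n n ℤ} {c d : n → ℤ} {N : ℤ} (hM : M.det ≠ 0)
    (hP : P.det ≠ 0) (hPd : Pᵀ * M * P = diagonal d) (hN : ∀ i, N = 2 * c i * d i) :
    P * diagonal (fun i => 2 * c i) * (Pᵀ * M) = N • (1 : Matrix n n ℤ) := by
  have h1 : Pᵀ * M * (P * diagonal fun i => 2 * c i) = N • (1 : Matrix n n ℤ) := by
    rw [← Matrix.mul_assoc, hPd, diagonal_mul_diagonal, smul_one_eq_diagonal]
    congr 1
    funext i
    rw [hN i]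
    ring
  refine mul_eq_smul_one_symm h1 ?_
  rw [det_mul, det_transpose]
  exact mul_ne_zero hP hM

theorem exists_pos_sum_stdAddChar_eq {N : ℕ} [NeZero N] {M P : Matrix n n ℤ} {c d : n → ℤ}
    (hM : M.IsSymm) (heven : ∀ x : n → ℤ, 2 ∣ x ⬝ᵥ M *ᵥ x) (hdet : IsUnit M.det)
    (hP : P.det ≠ 0) (hPd : Pᵀ * M * P = diagonal d) (hN : ∀ i, (N : ℤ) = 2 * c i * d i) :
    ∃ r : ℝ, 0 < r ∧
      ∑ k : n → ZMod N, ZMod.stdAddChar (∑ i, (c i : ZMod N) * k i ^ 2) = (r : ℂ) := by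
  classical
  set T : Matrix n n ℤ := Pᵀ * M with hT
  have key : P * diagonal (fun i => 2 * c i) * T = (N : ℤ) • (1 : Matrix n n ℤ) :=
    two_smul_mul_diagonal_mul hdet.ne_zero hP hPd hN
  have hTt : Tᵀ = M * P := by rw [hT, transpose_mul, transpose_transpose, hM.eq]
  let T' : Matrix n n (ZMod N) := T.map (Int.castRingHom (ZMod N))
  let f : (n → ZMod N) → ℂ := fun k => ZMod.stdAddChar (∑ i, (c i : ZMod N) * k i ^ 2)
  let w : (n → ZMod N) → n → ZMod N := fun k => (fun i => 2 * (c i : ZMod N) * k i) ᵥ* T'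
  let χ : (n → ZMod N) → AddChar (n → ZMod N) ℂ := fun k =>
    ZMod.stdAddChar.compAddMonoidHom (AddMonoidHom.mk' (w k ⬝ᵥ ·) (dotProduct_add (w k)))
  have hlift (y : n → ZMod N) : ∃ Y : n → ℤ, y = Int.cast ∘ Y :=
    ⟨fun i => (ZMod.intCast_surjective (y i)).choose,
      funext fun i => (ZMod.intCast_surjective (y i)).choose_spec.symm⟩
  have hT' (Y : n → ℤ) : T' *ᵥ (Int.cast ∘ Y) = Int.cast ∘ (T *ᵥ Y) :=
    funext fun i => (RingHom.map_mulVec (Int.castRingHom (ZMod N)) T Y i).symm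
  have hsq (y : n → ZMod N) : ∑ i, (c i : ZMod N) * (T' *ᵥ y) i ^ 2 = 0 := by
    obtain ⟨Y, rfl⟩ := hlift y
    obtain ⟨s, hs⟩ := heven Y
    have h2 : 2 * ∑ i, c i * (T *ᵥ Y) i ^ 2 = 2 * (N * s) := by
      calc 2 * ∑ i, c i * (T *ᵥ Y) i ^ 2
          = (T *ᵥ Y) ⬝ᵥ (diagonal (fun i => 2 * c i) *ᵥ (T *ᵥ Y)) := by
            rw [dotProduct, Finset.mul_sum]
            refine Finset.sum_congr rfl fun i _ => ?_
            rw [mulVec_diagonal]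
            ring
        _ = Y ⬝ᵥ ((M * (P * diagonal (fun i => 2 * c i) * T)) *ᵥ Y) := by
            rw [mulVec_mulVec, dotProduct_mulVec, vecMul_mulVec, ← dotProduct_mulVec, hTt]
            simp only [Matrix.mul_assoc]
        _ = 2 * (N * s) := by
            rw [key, Matrix.mul_smul, Matrix.mul_one, smul_mulVec, dotProduct_smul, hs, smul_eq_mul]
            ring
    rw [hT']
    have h3 := congrArg (Int.cast : ℤ → ZMod N) (mul_left_cancel₀ two_ne_zero h2)
    push_cast at h3
    simpa using h3
  have hf (k y : n → ZMod N) : f (k + T' *ᵥ y) = f k * χ k y := by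
    change ZMod.stdAddChar _ = ZMod.stdAddChar _ * ZMod.stdAddChar (w k ⬝ᵥ y)
    rw [← AddChar.map_add_eq_mul, ← dotProduct_mulVec]
    congr 1
    have hexp : ∑ i, (c i : ZMod N) * (k + T' *ᵥ y) i ^ 2 = ∑ i, (c i : ZMod N) * k i ^ 2 +
        (fun i => 2 * (c i : ZMod N) * k i) ⬝ᵥ T' *ᵥ y +
          ∑ i, (c i : ZMod N) * (T' *ᵥ y) i ^ 2 := by
      rw [dotProduct, ← Finset.sum_add_distrib, ← Finset.sum_add_distrib]
      refine Finset.sum_congr rfl fun i _ => ?_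
      rw [Pi.add_apply]
      ring
    rw [hexp, hsq, add_zero]
  have hf0 : f 0 = 1 := by simp [f]
  have hχ0 : χ 0 = 0 := by
    ext y
    have hw : w 0 = 0 := by
      change (fun i => 2 * (c i : ZMod N) * 0) ᵥ* T' = 0
      simp only [mul_zero]
      exact zero_vecMul T'
    change ZMod.stdAddChar (w 0 ⬝ᵥ y) = 1
    rw [hw, zero_dotProduct, AddChar.map_zero_eq_one]
  have hχ (k) (hk : χ k = 0) : f k = 1 := by
    have hw : w k = 0 := by
      by_contra hne
      obtain ⟨i, hi⟩ := Function.ne_iff.1 hne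
      refine ZMod.isPrimitive_stdAddChar N hi ?_
      ext x
      have := DFunLike.congr_fun hk (Pi.single i x)
      change ZMod.stdAddChar (w k ⬝ᵥ Pi.single i x) = 1 at this
      rwa [dotProduct_single] at this
    obtain ⟨K, rfl⟩ := hlift k
    have hw' : (Int.cast ∘ ((fun i => 2 * c i * K i) ᵥ* T) : n → ZMod N) = 0 := by
      rw [← hw]
      funext i
      simp [w, T', vecMul, dotProduct]
    have hdvd (i : n) : ∃ z : ℤ, ((fun i => 2 * c i * K i) ᵥ* T) i = N * z :=
      (ZMod.intCast_zmod_eq_zero_iff_dvd _ _).1 (congrFun hw' i)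
    choose z hz using hdvd
    have hKz : (N : ℤ) • K = (N : ℤ) • (T *ᵥ (M⁻¹ *ᵥ z)) := by
      have h1 : M *ᵥ (P *ᵥ (diagonal (fun i => 2 * c i) *ᵥ K)) = (N : ℤ) • z := by
        rw [mulVec_mulVec, ← hTt, mulVec_transpose,
          show diagonal (fun i => 2 * c i) *ᵥ K = fun i => 2 * c i * K i from
            funext (mulVec_diagonal _ _)]
        exact funext hz
      have h2 : P *ᵥ (diagonal (fun i => 2 * c i) *ᵥ K) = (N : ℤ) • (M⁻¹ *ᵥ z) := by
        rw [← mulVec_smul, ← h1, mulVec_mulVec _ M⁻¹ M, nonsing_inv_mul _ hdet, one_mulVec]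
      rw [← mulVec_smul, ← h2, mulVec_mulVec, hT, hPd, mulVec_mulVec, diagonal_mul_diagonal]
      funext i
      rw [mulVec_diagonal, Pi.smul_apply, hN i, smul_eq_mul]
      ring
    have hN0 : (N : ℤ) ≠ 0 := by exact_mod_cast NeZero.ne N
    have hK : K = T *ᵥ (M⁻¹ *ᵥ z) := smul_right_injective _ hN0 hKz
    have := hf 0 (Int.cast ∘ (M⁻¹ *ᵥ z))
    rwa [zero_add, hT', ← hK, hχ0, hf0, AddChar.zero_apply, one_mul] at this
  refine ⟨((Finset.univ.filter fun k => χ k = 0).card : ℝ), ?_, ?_⟩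
  · exact_mod_cast Finset.card_pos.2 ⟨0, by simpa using hχ0⟩
  · rw [Complex.ofReal_natCast]
    exact sum_eq_card_of_map_add_eq_mul hf hχ

end

theorem AddChar.map_finset_sum {A R ι : Type*} [AddCommMonoid A] [CommMonoid R] (ψ : AddChar A R)
    (s : Finset ι) (f : ι → A) : ψ (∑ i ∈ s, f i) = ∏ i ∈ s, ψ (f i) :=
  map_prod ψ.toMonoidHom (fun i => Multiplicative.ofAdd (f i)) s

theorem Matrix.IsHermitian.ncard_eigenvalues_eq {n : Type*} [Fintype n] [DecidableEq n]
    {A P : Matrix n n ℝ} (hA : A.IsHermitian) {d : n → ℝ} (hP : IsUnit P.det)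
    (h : Pᵀ * A * P = diagonal d) :
    {i | 0 < hA.eigenvalues i}.ncard = {i | 0 < d i}.ncard ∧
      {i | hA.eigenvalues i < 0}.ncard = {i | d i < 0}.ncard := by
  have hU : (hA.eigenvectorUnitary : Matrix n n ℝ)ᵀ * A * hA.eigenvectorUnitary =
      diagonal hA.eigenvalues := by
    have := hA.conjStarAlgAut_star_eigenvectorUnitary
    rw [Unitary.conjStarAlgAut_star_apply] at this
    exact this
  have hUdet : IsUnit (hA.eigenvectorUnitary : Matrix n n ℝ).det :=
    (isUnit_iff_isUnit_det _).1 ⟨Unitary.toUnits hA.eigenvectorUnitary, rfl⟩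
  have e₁ := equivalent_weightedSumSquares_of_transpose_mul_mul hUdet hU
  have e₂ := equivalent_weightedSumSquares_of_transpose_mul_mul hP h
  constructor
  · rw [← QuadraticForm.sigPos_of_equiv_weightedSumSquares e₁,
      ← QuadraticForm.sigPos_of_equiv_weightedSumSquares e₂]
  · rw [← QuadraticForm.sigNeg_of_equiv_weightedSumSquares e₁,
      ← QuadraticForm.sigNeg_of_equiv_weightedSumSquares e₂]

theorem Int.sum_sign_eq {n : Type*} [Fintype n] (d : n → ℤ) :
    ∑ i, (d i).sign = ({i | 0 < d i}.ncard : ℤ) - {i | d i < 0}.ncard := by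
  classical
  have hs (i : n) : (d i).sign = (if 0 < d i then 1 else 0) - (if d i < 0 then 1 else 0) := by
    rcases lt_trichotomy (d i) 0 with h | h | h
    · simp [Int.sign_eq_neg_one_of_neg h, h, not_lt.2 h.le]
    · simp [h]
    · simp [Int.sign_eq_one_of_pos h, h, not_lt.2 h.le]
  simp only [hs, Finset.sum_sub_distrib, Finset.sum_boole, Set.ncard_eq_toFinset_card',
    Set.toFinset_ofPred]

open Complex in
theorem eight_dvd_of_mul_exp_eq {r s : ℝ} (hr : 0 < r) (hs : 0 < s) {m : ℤ}
    (h : r * exp (Real.pi * I / 4 * m) = s) : 8 ∣ m := by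
  have hexp : Real.pi * I / 4 * m = ((Real.pi / 4 * m : ℝ) : ℂ) * I := by push_cast; ring
  rw [hexp] at h
  have hrs : r = s := by
    have := congrArg norm h
    rwa [norm_mul, norm_exp_ofReal_mul_I, mul_one, norm_real, norm_real, Real.norm_of_nonneg hr.le,
      Real.norm_of_nonneg hs.le] at this
  rw [hrs, mul_eq_left₀ (ofReal_ne_zero.2 hs.ne'), exp_eq_one_iff] at h
  obtain ⟨k, hk⟩ := h
  refine ⟨k, ?_⟩
  have hpi : (Real.pi : ℂ) ≠ 0 := ofReal_ne_zero.2 Real.pi_ne_zero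
  push_cast at hk
  have : (m : ℂ) = 8 * k := by
    refine mul_left_cancel₀ (mul_ne_zero hpi I_ne_zero) ?_
    linear_combination 4 * hk
  exact_mod_cast this

open Complex in
theorem eight_dvd_sum_sign {n : Type*} [Fintype n] [DecidableEq n] {M P : Matrix n n ℤ} {d : n → ℤ}
    (hM : M.IsSymm) (heven : ∀ x : n → ℤ, 2 ∣ x ⬝ᵥ M *ᵥ x) (hdet : IsUnit M.det)
    (hP : P.det ≠ 0) (hPd : Pᵀ * M * P = diagonal d) : 8 ∣ ∑ i, (d i).sign := by
  have hd0 (i : n) : d i ≠ 0 := by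
    have h := congrArg det hPd
    rw [det_mul, det_mul, det_transpose, det_diagonal] at h
    have hne : ∏ i, d i ≠ 0 := h ▸ mul_ne_zero (mul_ne_zero hP hdet.ne_zero) hP
    exact Finset.prod_ne_zero_iff.1 hne i (Finset.mem_univ i)
  have hd2 (i : n) : 2 ∣ d i := by
    have h := heven (P *ᵥ Pi.single i 1)
    rwa [mulVec_mulVec, dotProduct_mulVec, vecMul_mulVec, ← dotProduct_mulVec, ← Matrix.mul_assoc,
      hPd, single_one_dotProduct, mulVec_diagonal, Pi.single_eq_same, mul_one] at h
  let N : ℕ := 2 * ∏ i, (d i).natAbs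
  have : NeZero N := ⟨mul_ne_zero two_ne_zero
    (Finset.prod_ne_zero_iff.2 fun i _ => Int.natAbs_ne_zero.2 (hd0 i))⟩
  have hdvd (i : n) : ∃ c : ℤ, (N : ℤ) = 2 * c * d i := by
    have h : d i ∣ ((∏ i, (d i).natAbs : ℕ) : ℤ) :=
      Int.dvd_natCast.2 (Finset.dvd_prod_of_mem _ (Finset.mem_univ i))
    obtain ⟨c, hc⟩ := h
    refine ⟨c, ?_⟩
    rw [Nat.cast_mul, hc]
    push_cast
    ring
  choose c hc using hdvd
  obtain ⟨s, hs, hsum⟩ := exists_pos_sum_stdAddChar_eq hM heven hdet hP hPd hc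
  choose r hr hgauss using fun i => sum_stdAddChar_mul_sq (hd2 i) (hc i)
  refine eight_dvd_of_mul_exp_eq (r := ∏ i, r i) (Finset.prod_pos fun i _ => hr i) hs ?_
  rw [← hsum]
  simp_rw [AddChar.map_finset_sum]
  rw [← Fintype.prod_sum (fun i (x : ZMod N) => ZMod.stdAddChar ((c i : ZMod N) * x ^ 2))]
  simp_rw [hgauss]
  rw [Finset.prod_mul_distrib, ← exp_sum, ← Finset.mul_sum]
  push_cast
  rfl

/-- An even unimodular symmetric bilinear form over ℤ has signature divisible
by 8: if M is a symmetric integer matrix with Q(x,x) = xᵀMx always even and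
det M = ±1, then (number of positive eigenvalues) − (number of negative
eigenvalues) of M over ℝ is divisible by 8. -/
theorem even_unimodular_signature_div_eight {m : ℕ}
    (M : Matrix (Fin m) (Fin m) ℤ) (hsymm : M.IsSymm)
    (heven : ∀ x : Fin m → ℤ, 2 ∣ x ⬝ᵥ M.mulVec x)
    (hdet : M.det = 1 ∨ M.det = -1)
    (hherm : (M.map ((↑) : ℤ → ℝ)).IsHermitian) :
    (8 : ℤ) ∣ (((Finset.univ.filter fun i => 0 < hherm.eigenvalues i).card : ℤ)
      - ((Finset.univ.filter fun i => hherm.eigenvalues i < 0).card : ℤ)) := by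
  obtain ⟨P, d, hP, hPd⟩ := exists_int_diagonalization hsymm
  have hPR : (P.map (Int.castRingHom ℝ))ᵀ * M.map ((↑) : ℤ → ℝ) * P.map (Int.castRingHom ℝ) =
      diagonal fun i => (d i : ℝ) := by
    have h := congrArg (fun A => A.map (Int.castRingHom ℝ)) hPd
    simp only [Matrix.map_mul, transpose_map, diagonal_map (map_zero _)] at h
    exact h
  have hPdet : IsUnit (P.map (Int.castRingHom ℝ)).det := by
    rw [← RingHom.mapMatrix_apply, ← RingHom.map_det, isUnit_iff_ne_zero]
    exact Int.cast_ne_zero.2 hP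
  obtain ⟨hpos, hneg⟩ := hherm.ncard_eigenvalues_eq hPdet hPR
  have h8 := eight_dvd_sum_sign hsymm heven (Int.isUnit_iff.2 hdet) hP hPd
  rw [Int.sum_sign_eq] at h8
  simp only [Int.cast_pos, Int.cast_lt_zero] at hpos hneg
  rw [← hpos, ← hneg] at h8
  simpa only [Set.ncard_eq_toFinset_card', Set.toFinset_ofPred] using h8
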